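/- Let n ∈ ℕ, let K be a singular, strictly concave and strictly monotone (SM) kernel function, let J be an upper semicontinuous n-field function, and let r₁,…,rₙ > 0. Then M(S) = m(S), and there exists a unique equioscillation point w ∈ S̄ (i.e., a unique w with m₀(w) = ⋯ = mₙ(w)); this w belongs to Y ⊆ S; w is the unique point of S̄ with m̄(w) = M(S) and also the unique point of S̄ with m̲(w) = m(S). Moreover the Sandwich Property holds: for every x ∈ S, m̲(x) ≤ M(S) = m(S) ≤ m̄(x). -/

import Mathlib

open Set Filter

noncomputable section

/-- A kernel function: `ℝ ∪ {−∞}`-valued (modeled as `EReal`, never `⊤`),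
finite and concave on `(-1,0)` and `(0,1)`, extended continuously to `[-1,1]`. -/
structure IsKernel (K : ℝ → EReal) : Prop where
  ne_top : ∀ t, K t ≠ ⊤
  finite_off_zero : ∀ t ∈ Ioo (-1:ℝ) 1, t ≠ 0 → K t ≠ ⊥
  concave_neg : ConcaveOn ℝ (Ioo (-1:ℝ) 0) (fun t => (K t).toReal)
  concave_pos : ConcaveOn ℝ (Ioo (0:ℝ) 1) (fun t => (K t).toReal)
  lim_zero_left : Tendsto K (nhdsWithin 0 (Iio 0)) (nhds (K 0))
  lim_zero_right : Tendsto K (nhdsWithin 0 (Ioi 0)) (nhds (K 0))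
  lim_neg_one : Tendsto K (nhdsWithin (-1) (Ioi (-1))) (nhds (K (-1)))
  lim_one : Tendsto K (nhdsWithin 1 (Iio 1)) (nhds (K 1))

/-- Singularity condition `(∞)`: `K(0) = −∞`. -/
def SingularKernel (K : ℝ → EReal) : Prop := K 0 = ⊥

/-- Monotonicity condition (M). -/
def MonotoneKernel (K : ℝ → EReal) : Prop :=
  AntitoneOn K (Ioo (-1:ℝ) 0) ∧ MonotoneOn K (Ioo (0:ℝ) 1)

/-- Strict monotonicity condition (SM). -/
def StrictMonotoneKernel (K : ℝ → EReal) : Prop :=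
  StrictAntiOn K (Ico (-1:ℝ) 0) ∧ StrictMonoOn K (Ioc (0:ℝ) 1)

/-- Strict concavity of a kernel function. -/
def StrictConcaveKernel (K : ℝ → EReal) : Prop :=
  StrictConcaveOn ℝ (Ioo (-1:ℝ) 0) (fun t => (K t).toReal) ∧
  StrictConcaveOn ℝ (Ioo (0:ℝ) 1) (fun t => (K t).toReal)

/-- An `n`-field function: bounded above, never `+∞`, finite on a set of weighted
cardinality exceeding `n` (interior points of `[0,1]` count `1`, the endpoints `1/2`). -/
def IsFieldFn (n : ℕ) (J : ℝ → EReal) : Prop :=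
  (∀ t, J t ≠ ⊤) ∧ (∃ M : ℝ, ∀ t ∈ Icc (0:ℝ) 1, J t ≤ (M : EReal)) ∧
  ∃ T : Finset ℝ, (T : Set ℝ) ⊆ Icc (0:ℝ) 1 ∧ (∀ t ∈ T, J t ≠ ⊥) ∧
    (n : ℝ) < ∑ t ∈ T, (if t = 0 ∨ t = 1 then (1/2 : ℝ) else 1)

/-- The closed simplex `S̄`. -/
def closedSimplex (n : ℕ) : Set (Fin n → ℝ) :=
  {y | Monotone y ∧ ∀ j, y j ∈ Icc (0:ℝ) 1}

/-- The open simplex `S`. -/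
def openSimplex (n : ℕ) : Set (Fin n → ℝ) :=
  {y | StrictMono y ∧ ∀ j, y j ∈ Ioo (0:ℝ) 1}

/-- Extended nodes: `y₀ = 0`, `y_{n+1} = 1`. -/
def extNode {n : ℕ} (y : Fin n → ℝ) (j : Fin (n + 2)) : ℝ :=
  if _h0 : (j : ℕ) = 0 then 0
  else if _hn : (j : ℕ) ≤ n then y ⟨(j : ℕ) - 1, by omega⟩
  else 1

/-- The interval `I_j(y) = [y_j, y_{j+1}]`, `j = 0, …, n`. -/
def nodeInterval {n : ℕ} (y : Fin n → ℝ) (j : Fin (n + 1)) : Set ℝ :=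
  Icc (extNode y j.castSucc) (extNode y j.succ)

/-- The sum of translates function `F(y,t) = J(t) + ∑ⱼ rⱼ K(t - yⱼ)`. -/
def sumTrans {n : ℕ} (r : Fin n → ℝ) (K J : ℝ → EReal) (y : Fin n → ℝ) (t : ℝ) : EReal :=
  J t + ∑ j, (r j : EReal) * K (t - y j)

/-- The interval maximum `m_j(y) = sup_{t ∈ I_j(y)} F(y,t)`. -/
def mj {n : ℕ} (r : Fin n → ℝ) (K J : ℝ → EReal) (j : Fin (n + 1)) (y : Fin n → ℝ) : EReal :=
  sSup (sumTrans r K J y '' nodeInterval y j)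

/-- `m̄(y) = max_j m_j(y)`. -/
def mbar {n : ℕ} (r : Fin n → ℝ) (K J : ℝ → EReal) (y : Fin n → ℝ) : EReal :=
  ⨆ j, mj r K J j y

/-- `m̲(y) = min_j m_j(y)`. -/
def munder {n : ℕ} (r : Fin n → ℝ) (K J : ℝ → EReal) (y : Fin n → ℝ) : EReal :=
  ⨅ j, mj r K J j y

/-- The regularity set `Y`. -/
def regSet {n : ℕ} (r : Fin n → ℝ) (K J : ℝ → EReal) : Set (Fin n → ℝ) :=
  {y ∈ openSimplex n | ∀ j, mj r K J j y ≠ ⊥}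

/-- Equioscillation: all interval maxima agree. -/
def Equioscillation {n : ℕ} (r : Fin n → ℝ) (K J : ℝ → EReal) (y : Fin n → ℝ) : Prop :=
  ∀ i j : Fin (n + 1), mj r K J i y = mj r K J j y

/-- Abel summation: a nonnegative antitone weight keeps sums with nonnegative
partial sums nonnegative. -/
theorem sum_mul_nonneg_of_partial_sums {ι : Type*} [LinearOrder ι] (s : Finset ι)
    (c d : ι → ℝ) (hc : AntitoneOn c s) (hc0 : ∀ k ∈ s, 0 ≤ c k)
    (hd : ∀ m ∈ s, 0 ≤ ∑ k ∈ s with k ≤ m, d k) : 0 ≤ ∑ k ∈ s, c k * d k := by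
  suffices H : ∀ e, 0 ≤ e → (∀ k ∈ s, e ≤ c k) → e * ∑ k ∈ s, d k ≤ ∑ k ∈ s, c k * d k by
    simpa using H 0 le_rfl hc0
  induction s using Finset.induction_on_max with
  | empty => simp
  | insert a s has ih =>
    intro e he hec
    have ha : a ∉ s := fun h => lt_irrefl _ (has a h)
    have htot : 0 ≤ ∑ k ∈ insert a s, d k := by
      have h := hd a (Finset.mem_insert_self _ _)
      rwa [Finset.filter_true_of_mem] at h
      intro k hk
      rcases Finset.mem_insert.1 hk with rfl | hk
      · exact le_rfl
      · exact (has k hk).le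
    have hsub : (s : Set ι) ⊆ (insert a s : Finset ι) := by simp
    have hpart : ∀ m ∈ s, 0 ≤ ∑ k ∈ s with k ≤ m, d k := by
      intro m hm
      have h := hd m (Finset.mem_insert_of_mem hm)
      rwa [Finset.filter_insert, if_neg (not_le.2 (has m hm))] at h
    have hca := hc0 a (Finset.mem_insert_self _ _)
    have h1 := ih (hc.mono hsub) (fun k hk => hc0 k (Finset.mem_insert_of_mem hk)) hpart (c a) hca
      (fun k hk => hc (Finset.mem_insert_of_mem hk) (Finset.mem_insert_self _ _) (has k hk).le)
    have h2 := mul_le_mul_of_nonneg_right (hec a (Finset.mem_insert_self _ _)) htot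
    rw [Finset.sum_insert ha] at h2 ⊢
    rw [Finset.sum_insert ha]
    linarith

theorem StrictConcaveOn.Ioc_of_Ioo {φ : ℝ → ℝ} (h : StrictConcaveOn ℝ (Ioo 0 1) φ)
    (hcont : Tendsto φ (nhdsWithin 1 (Iio 1)) (nhds (φ 1))) :
    StrictConcaveOn ℝ (Ioc 0 1) φ := by
  refine strictConcaveOn_of_slope_strict_anti_adjacent (convex_Ioc 0 1) ?_
  intro x y z hx hz hxy hyz
  rcases hz.2.lt_or_eq with hz1 | rfl
  · exact h.slope_anti_adjacent ⟨hx.1, by linarith⟩ ⟨hz.1, hz1⟩ hxy hyz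
  have hx0 := hx.1
  obtain ⟨p, hyp, hp1⟩ := exists_between hyz
  have h1 := h.slope_anti_adjacent (x := x) (y := y) (z := p) ⟨hx0, by linarith⟩
    ⟨by linarith, hp1⟩ hxy hyp
  refine lt_of_le_of_lt ?_ h1
  have hlim : Tendsto (fun q => (φ q - φ y) / (q - y)) (nhdsWithin 1 (Iio 1))
      (nhds ((φ 1 - φ y) / (1 - y))) := by
    refine (hcont.sub_const _).div ?_ (by linarith)
    exact (tendsto_id.mono_left nhdsWithin_le_nhds).sub_const y
  refine le_of_tendsto hlim ?_
  filter_upwards [Ioo_mem_nhdsLT hp1] with q hq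
  have := h.secant_strict_mono (a := y) (x := p) (y := q) ⟨by linarith, by linarith⟩
    ⟨by linarith, hp1⟩ ⟨by linarith [hq.1], hq.2⟩ (by linarith) (by linarith [hq.1]) hq.1
  exact this.le

theorem StrictConcaveOn.exists_supergradient {φ : ℝ → ℝ} (h : StrictConcaveOn ℝ (Ioc 0 1) φ)
    (hm : MonotoneOn φ (Ioc 0 1)) :
    ∃ c : ℝ → ℝ, (∀ x ∈ Ioc (0 : ℝ) 1, 0 ≤ c x) ∧ AntitoneOn c (Ioc 0 1) ∧
      ∀ x ∈ Ioc (0 : ℝ) 1, ∀ y ∈ Ioc (0 : ℝ) 1, y ≠ x → φ y < φ x + c x * (y - x) := by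
  have key : ∀ x ∈ Ioc (0 : ℝ) 1, ∃ c : ℝ, 0 ≤ c ∧
      ∀ y ∈ Ioc (0 : ℝ) 1, y ≠ x → φ y < φ x + c * (y - x) := by
    intro x hx
    set S : Set ℝ := (fun s => (φ x - φ s) / (x - s)) '' Ioo 0 x with hS
    have hx0 := hx.1
    have hne : S.Nonempty := (nonempty_Ioo.2 hx0).image _
    have hpos : ∀ u ∈ S, 0 ≤ u := by
      rintro _ ⟨s, hs, rfl⟩
      exact div_nonneg (sub_nonneg.2 (hm ⟨hs.1, hs.2.le.trans hx.2⟩ hx hs.2.le))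
        (sub_nonneg.2 hs.2.le)
    refine ⟨sInf S, le_csInf hne hpos, fun y hy hyx => ?_⟩
    rcases hyx.lt_or_gt with hlt | hgt
    · obtain ⟨p, hyp, hpx⟩ := exists_between hlt
      have h1 := h.secant_strict_mono (a := x) (x := y) (y := p) hx hy
        ⟨by linarith [hy.1], by linarith [hx.2]⟩ hyx hpx.ne hyp
      have h2 : sInf S ≤ (φ x - φ p) / (x - p) :=
        csInf_le ⟨0, hpos⟩ ⟨p, ⟨by linarith [hy.1], hpx⟩, rfl⟩
      rw [← neg_div_neg_eq, neg_sub, neg_sub] at h2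
      have h3 := h2.trans_lt h1
      rw [lt_div_iff_of_neg (by linarith)] at h3
      linarith
    · obtain ⟨p, hxp, hpy⟩ := exists_between hgt
      have hp : p ∈ Ioc (0 : ℝ) 1 := ⟨by linarith, by linarith [hy.2]⟩
      have h1 := h.secant_strict_mono (a := x) (x := p) (y := y) hx hp hy hxp.ne' hyx hpy
      have h2 : (φ p - φ x) / (p - x) ≤ sInf S := by
        refine le_csInf hne ?_
        rintro _ ⟨s, hs, rfl⟩
        exact (h.slope_anti_adjacent ⟨hs.1, by linarith [hs.2, hx.2]⟩ hp hs.2 hxp).le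
      have h3 := h1.trans_le h2
      rw [div_lt_iff₀ (by linarith)] at h3
      linarith
  choose! c hc0 hc using key
  refine ⟨c, hc0, fun x hx y hy hxy => ?_, hc⟩
  rcases hxy.eq_or_lt with rfl | hlt
  · exact le_rfl
  have h1 := hc x hx y hy hlt.ne'
  have h2 := hc y hy x hx hlt.ne
  nlinarith

/-- A weighted weak majorization inequality. -/
theorem StrictConcaveOn.sum_le_sum_of_partial_sums {ι : Type*} [LinearOrder ι] {φ : ℝ → ℝ}
    (h : StrictConcaveOn ℝ (Ioc 0 1) φ) (hm : MonotoneOn φ (Ioc 0 1)) (s : Finset ι)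
    {r a b : ι → ℝ} (hr : ∀ k ∈ s, 0 < r k) (ha : ∀ k ∈ s, a k ∈ Ioc (0 : ℝ) 1)
    (hb : ∀ k ∈ s, b k ∈ Ioc (0 : ℝ) 1) (hmono : MonotoneOn a s)
    (hd : ∀ m ∈ s, 0 ≤ ∑ k ∈ s with k ≤ m, r k * (a k - b k)) :
    ∑ k ∈ s, r k * φ (b k) ≤ ∑ k ∈ s, r k * φ (a k) ∧
      ((∃ k ∈ s, a k ≠ b k) → ∑ k ∈ s, r k * φ (b k) < ∑ k ∈ s, r k * φ (a k)) := by
  obtain ⟨c, hc0, hcanti, hc⟩ := h.exists_supergradient hm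
  have habel := sum_mul_nonneg_of_partial_sums s (fun k => c (a k)) (fun k => r k * (a k - b k))
    (fun k hk l hl hkl => hcanti (ha k hk) (ha l hl) (hmono hk hl hkl))
    (fun k hk => hc0 _ (ha k hk)) hd
  have hterm : ∀ k ∈ s, a k ≠ b k →
      r k * φ (b k) < r k * φ (a k) - c (a k) * (r k * (a k - b k)) := by
    intro k hk hne
    have := mul_lt_mul_of_pos_left (hc _ (ha k hk) _ (hb k hk) hne.symm) (hr k hk)
    linarith
  have hterm' : ∀ k ∈ s, r k * φ (b k) ≤ r k * φ (a k) - c (a k) * (r k * (a k - b k)) := by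
    intro k hk
    by_cases hne : a k = b k
    · simp [hne]
    · exact (hterm k hk hne).le
  have hsum : ∑ k ∈ s, (r k * φ (a k) - c (a k) * (r k * (a k - b k))) ≤
      ∑ k ∈ s, r k * φ (a k) := by
    rw [Finset.sum_sub_distrib]
    linarith
  refine ⟨(Finset.sum_le_sum hterm').trans hsum, ?_⟩
  rintro ⟨k, hk, hne⟩
  exact (Finset.sum_lt_sum hterm' ⟨k, hk, hterm k hk hne⟩).trans_le hsum

theorem IsKernel.ne_bot {K : ℝ → EReal} (hK : IsKernel K) (hsm : StrictMonotoneKernel K) {t : ℝ}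
    (ht : t ∈ Icc (-1 : ℝ) 1) (h0 : t ≠ 0) : K t ≠ ⊥ := by
  rcases ht.1.eq_or_lt with rfl | h1
  · exact (bot_le.trans_lt (hsm.1 (show (-1 : ℝ) ∈ Ico (-1) 0 by norm_num)
      (show (-1 / 2 : ℝ) ∈ Ico (-1) 0 by norm_num) (by norm_num))).ne'
  rcases ht.2.eq_or_lt with rfl | h2
  · exact (bot_le.trans_lt (hsm.2 (show (1 / 2 : ℝ) ∈ Ioc 0 1 by norm_num)
      (show (1 : ℝ) ∈ Ioc 0 1 by norm_num) (by norm_num))).ne'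
  exact hK.finite_off_zero t ⟨h1, h2⟩ h0

theorem IsKernel.coe_toReal {K : ℝ → EReal} (hK : IsKernel K) (hsm : StrictMonotoneKernel K)
    {t : ℝ} (ht : t ∈ Icc (-1 : ℝ) 1) (h0 : t ≠ 0) : ((K t).toReal : EReal) = K t :=
  EReal.coe_toReal (hK.ne_top t) (hK.ne_bot hsm ht h0)

theorem IsKernel.continuousOn {K : ℝ → EReal} (hK : IsKernel K) (hsm : StrictMonotoneKernel K) :
    ContinuousOn K (Icc (-1) 1) := by
  have aux : ∀ a b : ℝ, -1 ≤ a → b ≤ 1 → (∀ t ∈ Ioo a b, t ≠ 0) →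
      ConcaveOn ℝ (Ioo a b) (fun t => (K t).toReal) → ∀ t ∈ Ioo a b, ContinuousAt K t := by
    intro a b ha hb h0 hc t ht
    have h1 := (hc.continuousOn isOpen_Ioo).continuousAt (isOpen_Ioo.mem_nhds ht)
    refine (continuous_coe_real_ereal.continuousAt.comp h1).congr ?_
    filter_upwards [isOpen_Ioo.mem_nhds ht] with s hs
    exact hK.coe_toReal hsm ⟨ha.trans hs.1.le, hs.2.le.trans hb⟩ (h0 s hs)
  intro t ht
  rcases ht.1.eq_or_lt with rfl | h1
  · exact (continuousWithinAt_Ioi_iff_Ici.1 hK.lim_neg_one).mono Icc_subset_Ici_self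
  rcases ht.2.eq_or_lt with rfl | h2
  · exact (continuousWithinAt_Iio_iff_Iic.1 hK.lim_one).mono Icc_subset_Iic_self
  refine ContinuousAt.continuousWithinAt ?_
  rcases lt_trichotomy t 0 with h | rfl | h
  · exact aux (-1) 0 le_rfl zero_le_one (fun t ht => ht.2.ne) hK.concave_neg t ⟨h1, h⟩
  · exact continuousAt_iff_continuous_left'_right'.2 ⟨hK.lim_zero_left, hK.lim_zero_right⟩
  · exact aux 0 1 (by norm_num) le_rfl (fun t ht => ht.1.ne') hK.concave_pos t ⟨h, h2⟩

theorem IsKernel.strictConcaveOn_right {K : ℝ → EReal} (hK : IsKernel K)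
    (hsm : StrictMonotoneKernel K) (hsc : StrictConcaveKernel K) :
    StrictConcaveOn ℝ (Ioc 0 1) (fun t => (K t).toReal) :=
  hsc.2.Ioc_of_Ioo ((EReal.tendsto_toReal (hK.ne_top 1)
    (hK.ne_bot hsm (by norm_num) one_ne_zero)).comp hK.lim_one)

theorem IsKernel.strictConcaveOn_left {K : ℝ → EReal} (hK : IsKernel K)
    (hsm : StrictMonotoneKernel K) (hsc : StrictConcaveKernel K) :
    StrictConcaveOn ℝ (Ioc 0 1) (fun t => (K (-t)).toReal) := by
  refine StrictConcaveOn.Ioc_of_Ioo ⟨convex_Ioo 0 1, ?_⟩ ?_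
  · intro x hx y hy hxy a b ha hb hab
    have := hsc.1.2 (x := -x) ⟨by linarith [hx.2], by linarith [hx.1]⟩ (y := -y)
      ⟨by linarith [hy.2], by linarith [hy.1]⟩ (by simpa using hxy) ha hb hab
    have e : -(a • x + b • y) = a • (-x) + b • (-y) := by simp [smul_eq_mul]; ring
    simpa only [e] using this
  · have h1 : Tendsto (fun t : ℝ => -t) (nhdsWithin 1 (Iio 1)) (nhdsWithin (-1) (Ioi (-1))) :=
      tendsto_neg_nhdsLT
    exact (EReal.tendsto_toReal (hK.ne_top (-1))
      (hK.ne_bot hsm (by norm_num) (by norm_num))).comp (hK.lim_neg_one.comp h1)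

theorem IsKernel.monotoneOn_right {K : ℝ → EReal} (hK : IsKernel K)
    (hsm : StrictMonotoneKernel K) : MonotoneOn (fun t => (K t).toReal) (Ioc 0 1) :=
  fun x hx y hy hxy => EReal.toReal_le_toReal (hsm.2.monotoneOn hx hy hxy)
    (hK.ne_bot hsm ⟨by linarith [hx.1], hx.2⟩ hx.1.ne') (hK.ne_top y)

theorem IsKernel.monotoneOn_left {K : ℝ → EReal} (hK : IsKernel K)
    (hsm : StrictMonotoneKernel K) : MonotoneOn (fun t => (K (-t)).toReal) (Ioc 0 1) :=
  fun x hx y hy hxy => EReal.toReal_le_toReal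
    (hsm.1.antitoneOn (a := -y) (b := -x) ⟨by linarith [hy.2], by linarith [hy.1]⟩
      ⟨by linarith [hx.2], by linarith [hx.1]⟩ (by linarith))
    (hK.ne_bot hsm ⟨by linarith [hx.2], by linarith [hx.1]⟩ (by linarith [hx.1]))
    (hK.ne_top _)

theorem mem_nodeInterval_iff {n : ℕ} (hn : 0 < n) {y : Fin n → ℝ} (hy : y ∈ closedSimplex n)
    {j : Fin (n + 1)} {t : ℝ} :
    t ∈ nodeInterval y j ↔ t ∈ Icc (0 : ℝ) 1 ∧ (∀ k : Fin n, (k : ℕ) < j → y k ≤ t) ∧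
      (∀ k : Fin n, (j : ℕ) ≤ k → t ≤ y k) := by
  have hj := j.2
  have hlo : extNode y j.castSucc ≤ t ∧ 0 ≤ t ↔ 0 ≤ t ∧ (∀ k : Fin n, (k : ℕ) < j → y k ≤ t) := by
    unfold extNode
    by_cases h0 : (j : ℕ) = 0
    · simp [h0]
    · have hjn : (j : ℕ) ≤ n := by omega
      simp only [Fin.val_castSucc, h0, hjn, dite_true, dite_false]
      constructor
      · rintro ⟨h, ht⟩
        exact ⟨ht, fun k hk => (hy.1 (Fin.le_def.2 (by simp; omega))).trans h⟩
      · rintro ⟨ht, h⟩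
        exact ⟨h ⟨j - 1, by omega⟩ (by simp only; omega), ht⟩
  have hhi : t ≤ extNode y j.succ ∧ t ≤ 1 ↔ t ≤ 1 ∧ (∀ k : Fin n, (j : ℕ) ≤ k → t ≤ y k) := by
    unfold extNode
    by_cases h0 : (j : ℕ) + 1 ≤ n
    · simp only [Fin.val_succ, h0, dite_true, dite_false, Nat.succ_ne_zero, Nat.add_sub_cancel]
      constructor
      · rintro ⟨h, ht⟩
        exact ⟨ht, fun k hk => h.trans (hy.1 (Fin.le_def.2 (by simpa using hk)))⟩
      · rintro ⟨ht, h⟩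
        exact ⟨h _ (by simp), ht⟩
    · simp only [Fin.val_succ, h0, dite_false, Nat.succ_ne_zero, and_self]
      exact ⟨fun h => ⟨h, fun k hk => absurd k.2 (by omega)⟩, fun h => h.1⟩
  have hlo' : 0 ≤ extNode y j.castSucc := by
    unfold extNode
    split_ifs
    exacts [le_rfl, (hy.2 _).1, zero_le_one]
  have hhi' : extNode y j.succ ≤ 1 := by
    unfold extNode
    split_ifs
    exacts [zero_le_one, (hy.2 _).2, le_rfl]
  constructor
  · intro h
    have h0 : 0 ≤ t := hlo'.trans h.1
    have h1 : t ≤ 1 := h.2.trans hhi'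
    exact ⟨⟨h0, h1⟩, (hlo.1 ⟨h.1, h0⟩).2, (hhi.1 ⟨h.2, h1⟩).2⟩
  · rintro ⟨⟨h0, h1⟩, h2, h3⟩
    exact ⟨(hlo.2 ⟨h0, h2⟩).1, (hhi.2 ⟨h1, h3⟩).1⟩

/-- The sum of the first `m` weighted coordinates. -/
def partialSum {n : ℕ} (r d : Fin n → ℝ) (m : ℕ) : ℝ :=
  ∑ k ∈ Finset.univ.filter (fun k : Fin n => (k : ℕ) < m), r k * d k

theorem partialSum_succ {n : ℕ} (r d : Fin n → ℝ) (m : Fin n) :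
    partialSum r d (m + 1) = partialSum r d m + r m * d m := by
  unfold partialSum
  have : (Finset.univ.filter fun k : Fin n => (k : ℕ) < m + 1) =
      insert m (Finset.univ.filter fun k : Fin n => (k : ℕ) < m) := by
    ext k
    simp [Fin.ext_iff]
    omega
  rw [this, Finset.sum_insert (by simp), add_comm]

/-- If the partial sums of the weighted displacements `r k * (x k - y k)` are minimal at `j`,
passing from `y` to `x` enlarges the `j`-th interval and raises the potential on it. -/
theorem sum_translates_lt {n : ℕ} (hn : 0 < n) {r : Fin n → ℝ} (hr : ∀ j, 0 < r j)
    {K : ℝ → EReal} (hK : IsKernel K) (hsc : StrictConcaveKernel K) (hsm : StrictMonotoneKernel K)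
    {x y : Fin n → ℝ} (hx : x ∈ closedSimplex n) (hy : y ∈ closedSimplex n) (hne : x ≠ y)
    {j : Fin (n + 1)}
    (hV : ∀ m ≤ n, partialSum r (fun k => x k - y k) j ≤ partialSum r (fun k => x k - y k) m)
    {t : ℝ} (ht : t ∈ nodeInterval y j) (hty : ∀ k, t ≠ y k) :
    t ∈ nodeInterval x j ∧ (∀ k, t ≠ x k) ∧
      ∑ k, r k * (K (t - y k)).toReal < ∑ k, r k * (K (t - x k)).toReal := by
  obtain ⟨ht01, hlo, hhi⟩ := (mem_nodeInterval_iff hn hy).1 ht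
  have hlo' : ∀ k : Fin n, (k : ℕ) < j → y k < t := fun k hk => (hlo k hk).lt_of_ne (hty k).symm
  have hhi' : ∀ k : Fin n, (j : ℕ) ≤ k → t < y k := fun k hk => (hhi k hk).lt_of_ne (hty k)
  have hjn : (j : ℕ) ≤ n := by omega
  have hxlo : ∀ k : Fin n, (k : ℕ) < j → x k < t := by
    intro k hk
    let i : Fin n := ⟨j - 1, by omega⟩
    have hi : (i : ℕ) + 1 = j := by simp [i]; omega
    have h1 := hV i i.2.le
    rw [← hi, partialSum_succ] at h1
    have h2 : x i - y i ≤ 0 := by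
      by_contra hcon
      have := mul_pos (hr i) (not_le.1 hcon)
      linarith
    have h3 := hx.1 (show k ≤ i from Fin.le_def.2 (by omega))
    have h4 := hlo' i (by omega)
    linarith
  have hxhi : ∀ k : Fin n, (j : ℕ) ≤ k → t < x k := by
    intro k hk
    let i : Fin n := ⟨j, by omega⟩
    have h1 := hV (i + 1) i.2
    rw [partialSum_succ] at h1
    have h2 : 0 ≤ x i - y i := by
      by_contra hcon
      have := mul_neg_of_pos_of_neg (hr i) (not_le.1 hcon)
      simp only [i] at h1 this
      linarith
    have h3 := hx.1 (show i ≤ k from Fin.le_def.2 (by simpa [i] using hk))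
    have h4 := hhi' i le_rfl
    linarith
  refine ⟨(mem_nodeInterval_iff hn hx).2 ⟨ht01, fun k hk => (hxlo k hk).le,
    fun k hk => (hxhi k hk).le⟩, ?_, ?_⟩
  · intro k
    rcases lt_or_ge (k : ℕ) j with h | h
    exacts [(hxlo k h).ne', (hxhi k h).ne]
  have hR := (hK.strictConcaveOn_left hsm hsc).sum_le_sum_of_partial_sums
    (hK.monotoneOn_left hsm) (Finset.univ.filter fun k : Fin n => ¬ (k : ℕ) < j)
    (r := r) (a := fun k => x k - t) (b := fun k => y k - t) (fun k _ => hr k)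
    (fun k hk => by
      have := hxhi k (by simpa using hk)
      exact ⟨by linarith, by linarith [(hx.2 k).2, ht01.1]⟩)
    (fun k hk => by
      have := hhi' k (by simpa using hk)
      exact ⟨by linarith, by linarith [(hy.2 k).2, ht01.1]⟩)
    (fun k _ l _ hkl => sub_le_sub_right (hx.1 hkl) t)
    (fun m hm => by
      have h := hV (m + 1) m.2
      rw [← sub_nonneg] at h
      refine h.trans_eq ?_
      have hm' : (j : ℕ) ≤ m := by simpa using hm
      unfold partialSum
      rw [Finset.filter_filter]
      simp only [Finset.sum_filter, ← Finset.sum_sub_distrib]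
      refine Finset.sum_congr rfl fun k _ => ?_
      simp only [Fin.le_def]
      split_ifs <;> first | omega | ring)
  have hS : ∀ k : Fin n, k ∈ Finset.univ.filter (fun k : Fin n => (k : ℕ) < j) ↔ (k : ℕ) < j := by
    simp
  have hL := (hK.strictConcaveOn_right hsm hsc).sum_le_sum_of_partial_sums (ι := (Fin n)ᵒᵈ)
    (hK.monotoneOn_right hsm) (Finset.univ.filter fun k : Fin n => (k : ℕ) < j)
    (r := fun k => r (OrderDual.ofDual k)) (a := fun k => t - x (OrderDual.ofDual k))
    (b := fun k => t - y (OrderDual.ofDual k)) (fun k _ => hr _)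
    (fun k hk => by
      have := hxlo _ ((hS _).1 hk)
      exact ⟨sub_pos.2 this, by linarith [(hx.2 (OrderDual.ofDual k)).1, ht01.2]⟩)
    (fun k hk => by
      have := hlo' _ ((hS _).1 hk)
      exact ⟨sub_pos.2 this, by linarith [(hy.2 (OrderDual.ofDual k)).1, ht01.2]⟩)
    (fun k _ l _ hkl => sub_le_sub_left (hx.1 hkl) t)
    (fun m hm => by
      have hm' : ((OrderDual.ofDual m : Fin n) : ℕ) < j := (hS _).1 hm
      have h := hV (OrderDual.ofDual m : Fin n) (by omega)
      rw [← sub_nonneg] at h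
      refine h.trans_eq ?_
      change _ = ∑ k ∈ (Finset.univ.filter fun k : Fin n => (k : ℕ) < j).filter
        (fun k => OrderDual.ofDual m ≤ k), r k * (t - x k - (t - y k))
      unfold partialSum
      rw [Finset.filter_filter]
      simp only [Finset.sum_filter, ← Finset.sum_sub_distrib]
      refine Finset.sum_congr rfl fun k _ => ?_
      simp only [Fin.le_def]
      split_ifs <;> first | omega | ring)
  simp only [neg_sub] at hR
  rw [← Finset.sum_filter_add_sum_filter_not Finset.univ (fun k : Fin n => (k : ℕ) < j),
    ← Finset.sum_filter_add_sum_filter_not Finset.univ (fun k : Fin n => (k : ℕ) < j)]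
  obtain ⟨k, hk⟩ := Function.ne_iff.1 hne
  rcases lt_or_ge (k : ℕ) j with h | h
  · exact add_lt_add_of_lt_of_le
      (hL.2 ⟨k, (hS k).2 h, fun h => hk (sub_right_injective h)⟩) hR.1
  · exact add_lt_add_of_le_of_lt hL.1
      (hR.2 ⟨k, by simpa using h, fun h => hk (by linarith)⟩)

theorem EReal.coe_finset_sum {ι : Type*} (s : Finset ι) (f : ι → ℝ) :
    ((∑ i ∈ s, f i : ℝ) : EReal) = ∑ i ∈ s, (f i : EReal) :=
  map_sum (⟨⟨Real.toEReal, EReal.coe_zero⟩, EReal.coe_add⟩ : ℝ →+ EReal) f s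

theorem EReal.sum_ne_top {ι : Type*} (s : Finset ι) {f : ι → EReal} (h : ∀ i ∈ s, f i ≠ ⊤) :
    ∑ i ∈ s, f i ≠ ⊤ := by
  classical
  induction s using Finset.induction_on with
  | empty => simp
  | insert a s ha ih =>
    rw [Finset.sum_insert ha]
    exact EReal.add_ne_top (h a (Finset.mem_insert_self _ _))
      (ih fun i hi => h i (Finset.mem_insert_of_mem hi))

theorem EReal.sum_eq_bot {ι : Type*} {s : Finset ι} {f : ι → EReal} {i : ι} (hi : i ∈ s)
    (h : f i = ⊥) : ∑ i ∈ s, f i = ⊥ := by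
  classical
  rw [← Finset.add_sum_erase s f hi, h, EReal.bot_add]

theorem EReal.continuousOn_sum {ι α : Type*} [TopologicalSpace α] {A : Set α} (s : Finset ι)
    {f : ι → α → EReal} (hf : ∀ i ∈ s, ContinuousOn (f i) A) (ht : ∀ i ∈ s, ∀ a, f i a ≠ ⊤) :
    ContinuousOn (fun a => ∑ i ∈ s, f i a) A := by
  classical
  induction s using Finset.induction_on with
  | empty => simpa using continuousOn_const
  | insert b s hb ih =>
    simp only [Finset.sum_insert hb]
    intro a ha
    have h1 := hf b (Finset.mem_insert_self _ _) a ha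
    have h2 := ih (fun i hi => hf i (Finset.mem_insert_of_mem hi))
      (fun i hi => ht i (Finset.mem_insert_of_mem hi)) a ha
    have h3 := EReal.continuousAt_add (p := (f b a, ∑ i ∈ s, f i a))
      (Or.inl (ht b (Finset.mem_insert_self _ _) a))
      (Or.inr (EReal.sum_ne_top s fun i hi => ht i (Finset.mem_insert_of_mem hi) a))
    exact h3.comp_continuousWithinAt (f := fun a => (f b a, ∑ i ∈ s, f i a)) (h1.prodMk h2)

theorem coe_mul_kernel_ne_top {K : ℝ → EReal} (hK : IsKernel K) {c : ℝ} (hc : 0 < c) (t : ℝ) :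
    (c : EReal) * K t ≠ ⊤ := by
  induction h : K t with
  | bot => simp [EReal.coe_mul_bot_of_pos hc]
  | coe x => rw [← EReal.coe_mul]; exact EReal.coe_ne_top _
  | top => exact absurd h (hK.ne_top t)

theorem sum_translates_ne_top {n : ℕ} {r : Fin n → ℝ} (hr : ∀ j, 0 < r j) {K : ℝ → EReal}
    (hK : IsKernel K) (y : Fin n → ℝ) (t : ℝ) : ∑ j, (r j : EReal) * K (t - y j) ≠ ⊤ :=
  EReal.sum_ne_top _ fun j _ => coe_mul_kernel_ne_top hK (hr j) _

theorem sub_mem_Icc_of_closedSimplex {n : ℕ} {y : Fin n → ℝ} (hy : y ∈ closedSimplex n) {t : ℝ}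
    (ht : t ∈ Icc (0 : ℝ) 1) (k : Fin n) : t - y k ∈ Icc (-1 : ℝ) 1 :=
  ⟨by linarith [ht.1, (hy.2 k).2], by linarith [ht.2, (hy.2 k).1]⟩

theorem continuousOn_sum_translates {n : ℕ} {r : Fin n → ℝ} (hr : ∀ j, 0 < r j) {K : ℝ → EReal}
    (hK : IsKernel K) (hsm : StrictMonotoneKernel K) :
    ContinuousOn (fun p : (Fin n → ℝ) × ℝ => ∑ j, (r j : EReal) * K (p.2 - p.1 j))
      (closedSimplex n ×ˢ Icc 0 1) := by
  refine EReal.continuousOn_sum _ (fun j _ => ?_) (fun j _ p => coe_mul_kernel_ne_top hK (hr j) _)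
  have h1 : ContinuousOn (fun p : (Fin n → ℝ) × ℝ => K (p.2 - p.1 j))
      (closedSimplex n ×ˢ Icc 0 1) :=
    (hK.continuousOn hsm).comp (by fun_prop) fun p hp => sub_mem_Icc_of_closedSimplex hp.1 hp.2 j
  intro p hp
  have hne : (r j : EReal) ≠ 0 := by exact_mod_cast (hr j).ne'
  have h2 := EReal.continuousAt_mul (p := ((r j : EReal), K (p.2 - p.1 j))) (Or.inl hne)
    (Or.inl hne) (Or.inl (EReal.coe_ne_bot _)) (Or.inl (EReal.coe_ne_top _))
  exact h2.comp_continuousWithinAt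
    (f := fun p : (Fin n → ℝ) × ℝ => ((r j : EReal), K (p.2 - p.1 j)))
    (continuousWithinAt_const.prodMk (h1 p hp))

theorem sumTrans_eq_of_ne {n : ℕ} (r : Fin n → ℝ) {K : ℝ → EReal} (J : ℝ → EReal)
    (hK : IsKernel K) (hsm : StrictMonotoneKernel K) {y : Fin n → ℝ} (hy : y ∈ closedSimplex n)
    {t : ℝ} (ht : t ∈ Icc (0 : ℝ) 1) (hty : ∀ k, t ≠ y k) :
    sumTrans r K J y t = J t + ((∑ k, r k * (K (t - y k)).toReal : ℝ) : EReal) := by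
  unfold sumTrans
  congr 1
  rw [EReal.coe_finset_sum]
  refine Finset.sum_congr rfl fun k _ => ?_
  rw [EReal.coe_mul, hK.coe_toReal hsm (sub_mem_Icc_of_closedSimplex hy ht k)
    (sub_ne_zero.2 (hty k))]

theorem sumTrans_node {n : ℕ} {r : Fin n → ℝ} (hr : ∀ j, 0 < r j) {K : ℝ → EReal} (J : ℝ → EReal)
    (hsing : SingularKernel K) (y : Fin n → ℝ) (k : Fin n) : sumTrans r K J y (y k) = ⊥ := by
  unfold sumTrans
  have h0 : K 0 = ⊥ := hsing
  rw [EReal.sum_eq_bot (Finset.mem_univ k), EReal.add_bot]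
  rw [sub_self, h0, EReal.coe_mul_bot_of_pos (hr k)]

theorem sumTrans_lt {n : ℕ} (hn : 0 < n) {r : Fin n → ℝ} (hr : ∀ j, 0 < r j)
    {K J : ℝ → EReal} (hK : IsKernel K) (hsing : SingularKernel K) (hsc : StrictConcaveKernel K)
    (hsm : StrictMonotoneKernel K) (hJ : ∀ t, J t ≠ ⊤) {x y : Fin n → ℝ}
    (hx : x ∈ closedSimplex n) (hy : y ∈ closedSimplex n) (hne : x ≠ y) {j : Fin (n + 1)}
    (hV : ∀ m ≤ n, partialSum r (fun k => x k - y k) j ≤ partialSum r (fun k => x k - y k) m)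
    {t : ℝ} (ht : t ∈ nodeInterval y j) (hF : sumTrans r K J y t ≠ ⊥) :
    t ∈ nodeInterval x j ∧ sumTrans r K J y t < sumTrans r K J x t := by
  have hty : ∀ k, t ≠ y k := by
    rintro k rfl
    exact hF (sumTrans_node hr J hsing y k)
  have ht01 := ((mem_nodeInterval_iff hn hy).1 ht).1
  obtain ⟨h1, h2, h3⟩ := sum_translates_lt hn hr hK hsc hsm hx hy hne hV ht hty
  refine ⟨h1, ?_⟩
  have hJt : J t ≠ ⊥ := by
    intro h
    exact hF (by rw [sumTrans, h, EReal.bot_add])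
  rw [sumTrans_eq_of_ne r J hK hsm hy ht01 hty, sumTrans_eq_of_ne r J hK hsm hx ht01 h2,
    ← EReal.coe_toReal (hJ t) hJt]
  exact EReal.add_lt_add_left_coe (by exact_mod_cast h3) _

theorem upperSemicontinuousOn_sumTrans {n : ℕ} {r : Fin n → ℝ} (hr : ∀ j, 0 < r j)
    {K J : ℝ → EReal} (hK : IsKernel K) (hsm : StrictMonotoneKernel K) (hJ : ∀ t, J t ≠ ⊤)
    (hJusc : UpperSemicontinuousOn J (Icc (0 : ℝ) 1)) :
    UpperSemicontinuousOn (fun p : (Fin n → ℝ) × ℝ => sumTrans r K J p.1 p.2)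
      (closedSimplex n ×ˢ Icc 0 1) := by
  intro p hp
  have h1 : UpperSemicontinuousWithinAt (fun p : (Fin n → ℝ) × ℝ => J p.2)
      (closedSimplex n ×ˢ Icc 0 1) p := by
    intro c hc
    have hsnd : Tendsto (fun p : (Fin n → ℝ) × ℝ => p.2)
        (nhdsWithin p (closedSimplex n ×ˢ Icc 0 1)) (nhdsWithin p.2 (Icc 0 1)) :=
      tendsto_nhdsWithin_iff.2 ⟨(continuous_snd.tendsto p).mono_left nhdsWithin_le_nhds,
        eventually_mem_nhdsWithin.mono fun q hq => hq.2⟩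
    exact hsnd.eventually (hJusc p.2 hp.2 c hc)
  have h2 := (continuousOn_sum_translates hr hK hsm p hp).upperSemicontinuousWithinAt
  exact h1.add' h2 (EReal.continuousAt_add (Or.inl (hJ _))
    (Or.inr (sum_translates_ne_top hr hK p.1 p.2)))

theorem lowerSemicontinuousOn_sumTrans {n : ℕ} {r : Fin n → ℝ} (hr : ∀ j, 0 < r j)
    {K J : ℝ → EReal} (hK : IsKernel K) (hsm : StrictMonotoneKernel K) (hJ : ∀ t, J t ≠ ⊤)
    {t : ℝ} (ht : t ∈ Icc (0 : ℝ) 1) :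
    LowerSemicontinuousOn (fun y : Fin n → ℝ => sumTrans r K J y t) (closedSimplex n) := by
  have h : ContinuousOn (fun y : Fin n → ℝ => ∑ j, (r j : EReal) * K (t - y j))
      (closedSimplex n) :=
    (continuousOn_sum_translates hr hK hsm).comp (f := fun y : Fin n → ℝ => (y, t))
      (by fun_prop) fun y hy => ⟨hy, ht⟩
  exact lowerSemicontinuousOn_const.add' h.lowerSemicontinuousOn fun y _ =>
    EReal.continuousAt_add (Or.inl (hJ _)) (Or.inr (sum_translates_ne_top hr hK y t))

theorem nodeInterval_nonempty {n : ℕ} {y : Fin n → ℝ} (hy : y ∈ closedSimplex n)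
    (j : Fin (n + 1)) : (nodeInterval y j).Nonempty := by
  refine nonempty_Icc.2 ?_
  unfold extNode
  simp only [Fin.val_castSucc, Fin.val_succ, Nat.succ_ne_zero, dite_false]
  by_cases h0 : (j : ℕ) = 0
  · rw [dif_pos h0]
    split_ifs
    exacts [(hy.2 _).1, zero_le_one]
  · rw [dif_neg h0, dif_pos (by omega)]
    split_ifs
    exacts [hy.1 (Fin.le_def.2 (by simp)), (hy.2 _).2]

theorem exists_mem_nodeInterval {n : ℕ} (hn : 0 < n) {y : Fin n → ℝ} (hy : y ∈ closedSimplex n)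
    {t : ℝ} (ht : t ∈ Icc (0 : ℝ) 1) : ∃ j, t ∈ nodeInterval y j := by
  classical
  have hex : ∃ m : ℕ, ∀ k : Fin n, m ≤ k → t ≤ y k := ⟨n, fun k hk => absurd k.2 (by omega)⟩
  have hle : Nat.find hex ≤ n := Nat.find_min' hex fun k hk => absurd k.2 (by omega)
  refine ⟨⟨Nat.find hex, by omega⟩, (mem_nodeInterval_iff hn hy).2 ⟨ht, fun k hk => ?_,
    fun k hk => Nat.find_spec hex k hk⟩⟩
  have h := Nat.find_min hex hk
  push Not at h
  obtain ⟨l, hkl, hl⟩ := h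
  exact (hy.1 (Fin.le_def.2 hkl)).trans hl.le

theorem continuous_extNode {n : ℕ} (j : Fin (n + 2)) :
    Continuous fun y : Fin n → ℝ => extNode y j := by
  unfold extNode
  split_ifs <;> fun_prop

theorem sumTrans_le_mj {n : ℕ} (r : Fin n → ℝ) (K J : ℝ → EReal) {y : Fin n → ℝ}
    {j : Fin (n + 1)} {t : ℝ} (ht : t ∈ nodeInterval y j) :
    sumTrans r K J y t ≤ mj r K J j y :=
  le_sSup (mem_image_of_mem _ ht)

theorem mj_le_mbar {n : ℕ} (r : Fin n → ℝ) (K J : ℝ → EReal) (y : Fin n → ℝ)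
    (j : Fin (n + 1)) : mj r K J j y ≤ mbar r K J y :=
  le_iSup (fun j => mj r K J j y) j

theorem munder_le_mj {n : ℕ} (r : Fin n → ℝ) (K J : ℝ → EReal) (y : Fin n → ℝ)
    (j : Fin (n + 1)) : munder r K J y ≤ mj r K J j y :=
  iInf_le (fun j => mj r K J j y) j

theorem mbar_eq_iSup {n : ℕ} (hn : 0 < n) (r : Fin n → ℝ) (K J : ℝ → EReal) {y : Fin n → ℝ}
    (hy : y ∈ closedSimplex n) : mbar r K J y = ⨆ t ∈ Icc (0 : ℝ) 1, sumTrans r K J y t := by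
  apply le_antisymm
  · refine iSup_le fun j => sSup_le ?_
    rintro _ ⟨t, ht, rfl⟩
    exact le_iSup₂ (f := fun t (_ : t ∈ Icc (0 : ℝ) 1) => sumTrans r K J y t) t
      ((mem_nodeInterval_iff hn hy).1 ht).1
  · refine iSup₂_le fun t ht => ?_
    obtain ⟨j, hj⟩ := exists_mem_nodeInterval hn hy ht
    exact (sumTrans_le_mj r K J hj).trans (mj_le_mbar r K J y j)

theorem mj_eq_bot {n : ℕ} {r : Fin n → ℝ} (hr : ∀ j, 0 < r j) {K : ℝ → EReal} (J : ℝ → EReal)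
    (hsing : SingularKernel K) {y : Fin n → ℝ} {j : Fin (n + 1)}
    (h : ∀ t ∈ nodeInterval y j, ∃ k, t = y k) : mj r K J j y = ⊥ := by
  refine sSup_eq_bot.2 ?_
  rintro _ ⟨t, ht, rfl⟩
  obtain ⟨k, rfl⟩ := h t ht
  exact sumTrans_node hr J hsing y k

theorem exists_mj_eq {n : ℕ} (hn : 0 < n) {r : Fin n → ℝ} (hr : ∀ j, 0 < r j)
    {K J : ℝ → EReal} (hK : IsKernel K) (hsm : StrictMonotoneKernel K) (hJ : ∀ t, J t ≠ ⊤)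
    (hJusc : UpperSemicontinuousOn J (Icc (0 : ℝ) 1)) {y : Fin n → ℝ} (hy : y ∈ closedSimplex n)
    (j : Fin (n + 1)) : ∃ t ∈ nodeInterval y j, mj r K J j y = sumTrans r K J y t := by
  have husc : UpperSemicontinuousOn (fun t => sumTrans r K J y t) (nodeInterval y j) := by
    intro t ht c hc
    have hsub : ∀ s ∈ nodeInterval y j, (y, s) ∈ closedSimplex n ×ˢ Icc (0 : ℝ) 1 :=
      fun s hs => ⟨hy, ((mem_nodeInterval_iff hn hy).1 hs).1⟩
    have htend : Tendsto (fun s : ℝ => (y, s)) (nhdsWithin t (nodeInterval y j))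
        (nhdsWithin (y, t) (closedSimplex n ×ˢ Icc 0 1)) :=
      tendsto_nhdsWithin_iff.2 ⟨((Continuous.prodMk_right y).tendsto t).mono_left
        nhdsWithin_le_nhds, eventually_mem_nhdsWithin.mono hsub⟩
    exact htend.eventually
      (upperSemicontinuousOn_sumTrans hr hK hsm hJ hJusc (y, t) (hsub t ht) c hc)
  obtain ⟨t, ht, hmax⟩ := husc.exists_isMaxOn (nodeInterval_nonempty hy j) isCompact_Icc
  refine ⟨t, ht, le_antisymm (sSup_le ?_) (sumTrans_le_mj r K J ht)⟩
  rintro _ ⟨s, hs, rfl⟩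
  exact hmax hs

theorem mbar_ne_bot {n : ℕ} (hn : 0 < n) {r : Fin n → ℝ} {K J : ℝ → EReal} (hK : IsKernel K)
    (hsm : StrictMonotoneKernel K) (hJ : IsFieldFn n J) {y : Fin n → ℝ}
    (hy : y ∈ closedSimplex n) : mbar r K J y ≠ ⊥ := by
  classical
  intro hbot
  obtain ⟨-, -, T, hT, hTfin, hcard⟩ := hJ
  have hsub : T ⊆ Finset.univ.image y := by
    intro t ht
    by_contra hcon
    have hty : ∀ k, t ≠ y k := by
      rintro k rfl
      exact hcon (Finset.mem_image_of_mem y (Finset.mem_univ k))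
    have h1 : sumTrans r K J y t = ⊥ := by
      rw [mbar_eq_iSup hn r K J hy] at hbot
      exact le_bot_iff.1 (hbot ▸ le_iSup₂ (f := fun t (_ : t ∈ Icc (0 : ℝ) 1) =>
        sumTrans r K J y t) t (hT ht))
    rw [sumTrans_eq_of_ne r J hK hsm hy (hT ht) hty, EReal.add_eq_bot_iff] at h1
    exact h1.elim (hTfin t ht) (EReal.coe_ne_bot _)
  have h2 : (T.card : ℝ) ≤ n := by
    have := (Finset.card_le_card hsub).trans Finset.card_image_le
    rw [Finset.card_univ, Fintype.card_fin] at this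
    exact_mod_cast this
  have h3 : ∑ t ∈ T, (if t = 0 ∨ t = 1 then (1 / 2 : ℝ) else 1) ≤ ∑ t ∈ T, 1 :=
    Finset.sum_le_sum fun t _ => by split_ifs <;> norm_num
  simp only [Finset.sum_const, nsmul_eq_mul, mul_one] at h3
  linarith

theorem isCompact_closedSimplex (n : ℕ) : IsCompact (closedSimplex n) := by
  have h : closedSimplex n = {y | Monotone y} ∩ univ.pi fun _ => Icc (0 : ℝ) 1 := by
    ext y
    simp only [closedSimplex, mem_ofPred_eq, mem_inter_iff, mem_univ_pi]
  rw [h]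
  exact (isCompact_univ_pi fun _ => isCompact_Icc).inter_left isClosed_monotone

theorem eventually_sumTrans_lt {n : ℕ} (hn : 0 < n) {r : Fin n → ℝ} (hr : ∀ j, 0 < r j)
    {K J : ℝ → EReal} (hK : IsKernel K) (hsm : StrictMonotoneKernel K) (hJ : ∀ t, J t ≠ ⊤)
    (hJusc : UpperSemicontinuousOn J (Icc (0 : ℝ) 1)) {w : Fin n → ℝ} (hw : w ∈ closedSimplex n)
    {j : Fin (n + 1)} {c : EReal} (hc : mj r K J j w < c) :
    ∀ᶠ y in nhds w, y ∈ closedSimplex n → ∀ t ∈ nodeInterval y j, sumTrans r K J y t < c := by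
  have key : ∀ᶠ y in nhds w, ∀ t ∈ Icc (0 : ℝ) 1,
      y ∈ closedSimplex n → t ∈ nodeInterval y j → sumTrans r K J y t < c := by
    refine isCompact_Icc.eventually_forall_of_forall_eventually fun t ht => ?_
    by_cases htw : t ∈ nodeInterval w j
    · have h := upperSemicontinuousOn_sumTrans hr hK hsm hJ hJusc (w, t) ⟨hw, ht⟩ c
        ((sumTrans_le_mj r K J htw).trans_lt hc)
      rw [eventually_nhdsWithin_iff] at h
      filter_upwards [h] with z hz hz1 hz2
      exact hz ⟨hz1, ((mem_nodeInterval_iff hn hz1).1 hz2).1⟩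
    · have hcl : IsClosed {z : (Fin n → ℝ) × ℝ | z.2 ∈ nodeInterval z.1 j} :=
        (isClosed_le ((continuous_extNode _).comp continuous_fst) continuous_snd).inter
          (isClosed_le continuous_snd ((continuous_extNode _).comp continuous_fst))
      filter_upwards [hcl.isOpen_compl.mem_nhds (x := (w, t)) htw] with z hz _ hz2
      exact absurd hz2 hz
  filter_upwards [key] with y hy hyS t ht
  exact hy t ((mem_nodeInterval_iff hn hyS).1 ht).1 hyS ht

/-- Two configurations cannot have comparable interval maxima. -/
theorem exists_mj_lt {n : ℕ} (hn : 0 < n) {r : Fin n → ℝ} (hr : ∀ j, 0 < r j)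
    {K J : ℝ → EReal} (hK : IsKernel K) (hsing : SingularKernel K) (hsc : StrictConcaveKernel K)
    (hsm : StrictMonotoneKernel K) (hJ : ∀ t, J t ≠ ⊤)
    (hJusc : UpperSemicontinuousOn J (Icc (0 : ℝ) 1)) {x w : Fin n → ℝ}
    (hx : x ∈ closedSimplex n) (hw : w ∈ closedSimplex n) (hne : x ≠ w)
    (hfin : ∀ j, mj r K J j w ≠ ⊥) : ∃ j, mj r K J j w < mj r K J j x := by
  obtain ⟨j, hj⟩ := Finite.exists_min
    fun j : Fin (n + 1) => partialSum r (fun k => x k - w k) j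
  obtain ⟨t, ht, hmax⟩ := exists_mj_eq hn hr hK hsm hJ hJusc hw j
  obtain ⟨h1, h2⟩ := sumTrans_lt hn hr hK hsing hsc hsm hJ hx hw hne (j := j)
    (fun m hm => hj ⟨m, by omega⟩) ht (hmax ▸ hfin j)
  exact ⟨j, hmax ▸ h2.trans_le (sumTrans_le_mj r K J h1)⟩

theorem mem_openSimplex {n : ℕ} (hn : 0 < n) {r : Fin n → ℝ} (hr : ∀ j, 0 < r j)
    {K J : ℝ → EReal} (hsing : SingularKernel K) {y : Fin n → ℝ} (hy : y ∈ closedSimplex n)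
    (hfin : ∀ j, mj r K J j y ≠ ⊥) : y ∈ openSimplex n := by
  refine ⟨fun k l hkl => (hy.1 hkl.le).lt_of_ne fun heq => ?_, fun k =>
    ⟨(hy.2 k).1.lt_of_ne fun heq => ?_, (hy.2 k).2.lt_of_ne fun heq => ?_⟩⟩
  · refine hfin l.castSucc (mj_eq_bot hr J hsing fun t ht => ⟨k, ?_⟩)
    obtain ⟨-, h1, h2⟩ := (mem_nodeInterval_iff hn hy).1 ht
    exact le_antisymm (heq ▸ h2 l le_rfl) (h1 k hkl)
  · refine hfin k.castSucc (mj_eq_bot hr J hsing fun t ht => ⟨k, ?_⟩)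
    obtain ⟨h0, -, h2⟩ := (mem_nodeInterval_iff hn hy).1 ht
    exact le_antisymm (h2 k le_rfl) (heq ▸ h0.1)
  · refine hfin k.succ (mj_eq_bot hr J hsing fun t ht => ⟨k, ?_⟩)
    obtain ⟨h0, h1, -⟩ := (mem_nodeInterval_iff hn hy).1 ht
    exact le_antisymm (heq ▸ h0.2) (h1 k (by simp))


theorem eventually_add_mul_le {a b p q : ℝ} (hab : a ≤ b) (h : a = b → p ≤ q) :
    ∀ᶠ ε in nhdsWithin (0 : ℝ) (Ioi 0), a + ε * p ≤ b + ε * q := by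
  rcases hab.lt_or_eq with hlt | heq
  · have hc : ContinuousAt (fun ε : ℝ => b + ε * q - (a + ε * p)) 0 := by fun_prop
    refine nhdsWithin_le_nhds ((hc.eventually (lt_mem_nhds (a := 0) ?_)).mono fun ε hε => ?_)
    · simpa using hlt
    · linarith
  · filter_upwards [self_mem_nhdsWithin] with ε hε
    have hε : 0 < ε := hε
    have := mul_le_mul_of_nonneg_left (h heq) hε.le
    linarith

theorem eventually_add_mul_mem_closedSimplex {n : ℕ} {w d : Fin n → ℝ} (hw : w ∈ closedSimplex n)
    (h0 : ∀ k, w k = 0 → 0 ≤ d k) (h1 : ∀ k, w k = 1 → d k ≤ 0)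
    (h : ∀ k l, k < l → w k = w l → d k ≤ d l) :
    ∀ᶠ ε in nhdsWithin (0 : ℝ) (Ioi 0), (fun k => w k + ε * d k) ∈ closedSimplex n := by
  have H0 : ∀ᶠ ε in nhdsWithin (0 : ℝ) (Ioi 0), ∀ k, 0 + ε * 0 ≤ w k + ε * d k :=
    eventually_all.2 fun k => eventually_add_mul_le (hw.2 k).1 fun e => h0 k e.symm
  have H1 : ∀ᶠ ε in nhdsWithin (0 : ℝ) (Ioi 0), ∀ k, w k + ε * d k ≤ 1 + ε * 0 :=
    eventually_all.2 fun k => eventually_add_mul_le (hw.2 k).2 (h1 k)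
  have H : ∀ᶠ ε in nhdsWithin (0 : ℝ) (Ioi 0), ∀ k l, k < l →
      w k + ε * d k ≤ w l + ε * d l :=
    eventually_all.2 fun k => eventually_all.2 fun l => eventually_imp_distrib_left.2 fun hkl =>
      eventually_add_mul_le (hw.1 hkl.le) (h k l hkl)
  filter_upwards [H0, H1, H] with ε e0 e1 e
  refine ⟨fun k l hkl => ?_, fun k => ⟨by simpa using e0 k, by simpa using e1 k⟩⟩
  rcases hkl.eq_or_lt with rfl | hlt
  · exact le_rfl
  · exact e k l hlt

theorem lowerSemicontinuousOn_mbar {n : ℕ} (hn : 0 < n) {r : Fin n → ℝ} (hr : ∀ j, 0 < r j)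
    {K J : ℝ → EReal} (hK : IsKernel K) (hsm : StrictMonotoneKernel K) (hJ : ∀ t, J t ≠ ⊤) :
    LowerSemicontinuousOn (mbar r K J) (closedSimplex n) := by
  have h : LowerSemicontinuousOn
      (fun y : Fin n → ℝ => ⨆ t ∈ Icc (0 : ℝ) 1, sumTrans r K J y t) (closedSimplex n) :=
    lowerSemicontinuousOn_biSup fun t ht => lowerSemicontinuousOn_sumTrans hr hK hsm hJ ht
  intro y hy c hc
  filter_upwards [h y hy c (lt_of_lt_of_eq hc (mbar_eq_iSup hn r K J hy)),
    self_mem_nhdsWithin] with z hz hzS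
  rwa [mbar_eq_iSup hn r K J hzS]

/-- A configuration that is not an equioscillation point does not minimize `mbar`. -/
theorem exists_mbar_lt {n : ℕ} (hn : 0 < n) {r : Fin n → ℝ} (hr : ∀ j, 0 < r j)
    {K J : ℝ → EReal} (hK : IsKernel K) (hsing : SingularKernel K) (hsc : StrictConcaveKernel K)
    (hsm : StrictMonotoneKernel K) (hJ : IsFieldFn n J)
    (hJusc : UpperSemicontinuousOn J (Icc (0 : ℝ) 1)) {w : Fin n → ℝ} (hw : w ∈ closedSimplex n)
    (hnot : ¬ Equioscillation r K J w) : ∃ y ∈ closedSimplex n, mbar r K J y < mbar r K J w := by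
  classical
  have hJt := hJ.1
  have hcbot : mbar r K J w ≠ ⊥ := mbar_ne_bot hn hK hsm hJ hw
  obtain ⟨a, ha⟩ : ∃ a, mj r K J a w = mbar r K J w :=
    exists_eq_ciSup_of_finite (f := fun j => mj r K J j w)
  obtain ⟨b, hb⟩ : ∃ b, mj r K J b w ≠ mbar r K J w := by
    by_contra! hall
    exact hnot fun i j => (hall i).trans (hall j).symm
  set c := mbar r K J w with hc
  set ind : ℕ → ℝ := fun m => if ∃ j : Fin (n + 1), (j : ℕ) = m ∧ mj r K J j w = c then 1 else 0
    with hind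
  have ind_one : ∀ j : Fin (n + 1), mj r K J j w = c → ind j = 1 := fun j hj =>
    if_pos ⟨j, rfl, hj⟩
  have ind_zero : ∀ j : Fin (n + 1), mj r K J j w ≠ c → ind j = 0 := fun j hj =>
    if_neg fun ⟨i, hij, hi⟩ => hj (Fin.ext hij ▸ hi)
  have ind_nonneg : ∀ m, 0 ≤ ind m := fun m => by
    simp only [hind]; split_ifs <;> norm_num
  have ind_le : ∀ m, ind m ≤ 1 := fun m => by
    simp only [hind]; split_ifs <;> norm_num
  have ind_degenerate : ∀ j : Fin (n + 1), (∀ t ∈ nodeInterval w j, ∃ k, t = w k) → ind j = 0 :=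
    fun j h => ind_zero j (mj_eq_bot hr J hsing h ▸ hcbot.symm)
  set d : Fin n → ℝ := fun k => (ind (k + 1) - ind k) / r k with hd
  have d_nonneg : ∀ k : Fin n, ind k = 0 → 0 ≤ d k := fun k hk =>
    div_nonneg (by rw [hk, sub_zero]; exact ind_nonneg _) (hr k).le
  have d_nonpos : ∀ k : Fin n, ind (k + 1) = 0 → d k ≤ 0 := fun k hk =>
    div_nonpos_of_nonpos_of_nonneg (by linarith [ind_nonneg k]) (hr k).le
  have hsum : ∀ ε : ℝ, ∀ m ≤ n,
      partialSum r (fun k => w k - (w k + ε * d k)) m = -ε * (ind m - ind 0) := by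
    intro ε m
    induction m with
    | zero => intro _; simp [partialSum]
    | succ m ih =>
      intro hm
      have h := partialSum_succ r (fun k => w k - (w k + ε * d k)) ⟨m, hm⟩
      simp only at h
      rw [h, ih (by omega)]
      have := (hr ⟨m, hm⟩).ne'
      simp only [hd]
      field_simp
      ring
  have hmem : ∀ᶠ ε in nhdsWithin (0 : ℝ) (Ioi 0), (fun k => w k + ε * d k) ∈ closedSimplex n := by
    refine eventually_add_mul_mem_closedSimplex hw (fun k hk => d_nonneg k ?_)
      (fun k hk => d_nonpos k ?_) (fun k l hkl heq => (d_nonpos k ?_).trans (d_nonneg l ?_))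
    · refine ind_degenerate k.castSucc fun t ht => ⟨k, ?_⟩
      obtain ⟨ht0, -, ht2⟩ := (mem_nodeInterval_iff hn hw).1 ht
      exact le_antisymm (ht2 k le_rfl) (hk ▸ ht0.1)
    · refine ind_degenerate k.succ fun t ht => ⟨k, ?_⟩
      obtain ⟨ht0, ht1, -⟩ := (mem_nodeInterval_iff hn hw).1 ht
      exact le_antisymm (hk ▸ ht0.2) (ht1 k (by simp))
    · refine ind_degenerate k.succ fun t ht => ⟨k, ?_⟩
      obtain ⟨-, ht1, ht2⟩ := (mem_nodeInterval_iff hn hw).1 ht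
      exact le_antisymm (heq ▸ ht2 l (by simpa using hkl)) (ht1 k (by simp))
    · refine ind_degenerate l.castSucc fun t ht => ⟨l, ?_⟩
      obtain ⟨-, ht1, ht2⟩ := (mem_nodeInterval_iff hn hw).1 ht
      exact le_antisymm (ht2 l le_rfl) (heq ▸ ht1 k hkl)
  have htend : Tendsto (fun ε : ℝ => fun k => w k + ε * d k) (nhdsWithin 0 (Ioi 0)) (nhds w) := by
    have h : Continuous fun ε : ℝ => fun k => w k + ε * d k := by fun_prop
    simpa using (h.tendsto 0).mono_left nhdsWithin_le_nhds
  have hlow : ∀ᶠ ε in nhdsWithin (0 : ℝ) (Ioi 0), ∀ j, mj r K J j w < c →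
      (fun k => w k + ε * d k) ∈ closedSimplex n →
      ∀ t ∈ nodeInterval (fun k => w k + ε * d k) j,
        sumTrans r K J (fun k => w k + ε * d k) t < c :=
    eventually_all.2 fun j => eventually_imp_distrib_left.2 fun hj =>
      htend.eventually (eventually_sumTrans_lt hn hr hK hsm hJt hJusc hw hj)
  have hpos : ∀ᶠ ε in nhdsWithin (0 : ℝ) (Ioi 0), 0 < ε := self_mem_nhdsWithin
  obtain ⟨ε, hyS, hε, hlt⟩ := (hmem.and (hpos.and hlow)).exists
  set y : Fin n → ℝ := fun k => w k + ε * d k with hy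
  have hne : w ≠ y := by
    intro heq
    have hconst : ∀ j : Fin (n + 1), ind j = ind 0 := by
      intro j
      have h := hsum ε j (by omega)
      have h0 : partialSum r (fun k => w k - (w k + ε * d k)) j = 0 := by
        have : (fun k => w k - (w k + ε * d k)) = 0 := by
          funext k
          exact sub_eq_zero.2 (congrFun heq k)
        rw [this]
        simp [partialSum]
      rw [h0] at h
      have := (mul_eq_zero.1 h.symm).resolve_left (neg_ne_zero.2 hε.ne')
      linarith
    have h1 := (hconst a).trans (hconst b).symm
    rw [ind_one a ha, ind_zero b hb] at h1
    exact one_ne_zero h1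
  refine ⟨y, hyS, ?_⟩
  obtain ⟨j, hj⟩ : ∃ j, mj r K J j y = mbar r K J y :=
    exists_eq_ciSup_of_finite (f := fun j => mj r K J j y)
  obtain ⟨t, ht, hmax⟩ := exists_mj_eq hn hr hK hsm hJt hJusc hyS j
  rw [← hj, hmax]
  rcases (mj_le_mbar r K J w j).lt_or_eq with hjw | hjw
  · exact hlt j hjw hyS t ht
  · by_cases hF : sumTrans r K J y t = ⊥
    · exact hF ▸ bot_lt_iff_ne_bot.2 hcbot
    · obtain ⟨h1, h2⟩ := sumTrans_lt hn hr hK hsing hsc hsm hJt hw hyS hne (j := j)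
        (fun m hm => by
          have e1 := hsum ε j (by omega)
          have e2 := hsum ε m hm
          rw [e1, e2, ind_one j hjw]
          nlinarith [ind_le m]) ht hF
      exact h2.trans_le ((sumTrans_le_mj r K J h1).trans (mj_le_mbar r K J w j))

theorem exists_equioscillation {n : ℕ} (hn : 0 < n) {r : Fin n → ℝ} (hr : ∀ j, 0 < r j)
    {K J : ℝ → EReal} (hK : IsKernel K) (hsing : SingularKernel K) (hsc : StrictConcaveKernel K)
    (hsm : StrictMonotoneKernel K) (hJ : IsFieldFn n J)
    (hJusc : UpperSemicontinuousOn J (Icc (0 : ℝ) 1)) :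
    ∃ w ∈ closedSimplex n, Equioscillation r K J w := by
  have hne : (closedSimplex n).Nonempty :=
    ⟨fun _ => 0, monotone_const, fun _ => ⟨le_rfl, zero_le_one⟩⟩
  obtain ⟨w, hw, hmin⟩ := (lowerSemicontinuousOn_mbar hn hr hK hsm hJ.1).exists_isMinOn hne
    (isCompact_closedSimplex n)
  refine ⟨w, hw, by_contra fun hnot => ?_⟩
  obtain ⟨y, hy, hlt⟩ := exists_mbar_lt hn hr hK hsing hsc hsm hJ hJusc hw hnot
  exact (hmin hy).not_gt hlt

theorem openSimplex_subset_closedSimplex (n : ℕ) : openSimplex n ⊆ closedSimplex n :=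
  fun _ hy => ⟨hy.1.monotone, fun j => Ioo_subset_Icc_self (hy.2 j)⟩

theorem Equioscillation.mj_eq_mbar {n : ℕ} {r : Fin n → ℝ} {K J : ℝ → EReal} {w : Fin n → ℝ}
    (hw : Equioscillation r K J w) (j : Fin (n + 1)) : mj r K J j w = mbar r K J w :=
  (mj_le_mbar r K J w j).antisymm (iSup_le fun i => (hw i j).le)

theorem Equioscillation.mj_eq_munder {n : ℕ} {r : Fin n → ℝ} {K J : ℝ → EReal} {w : Fin n → ℝ}
    (hw : Equioscillation r K J w) (j : Fin (n + 1)) : mj r K J j w = munder r K J w :=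
  (le_iInf fun i => (hw j i).le).antisymm (munder_le_mj r K J w j)

theorem statement9 (n : ℕ) (hn : 0 < n) (r : Fin n → ℝ) (hr : ∀ j, 0 < r j)
    (K J : ℝ → EReal) (hK : IsKernel K)
    (hsing : SingularKernel K) (hsc : StrictConcaveKernel K) (hsm : StrictMonotoneKernel K)
    (hJ : IsFieldFn n J) (hJusc : UpperSemicontinuousOn J (Icc (0:ℝ) 1)) :
    (⨅ x ∈ openSimplex n, mbar r K J x) = (⨆ x ∈ openSimplex n, munder r K J x) ∧
    ∃ w ∈ regSet r K J, Equioscillation r K J w ∧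
      mbar r K J w = (⨅ x ∈ openSimplex n, mbar r K J x) ∧
      munder r K J w = (⨆ x ∈ openSimplex n, munder r K J x) ∧
      (∀ w' ∈ closedSimplex n, Equioscillation r K J w' → w' = w) ∧
      (∀ x ∈ closedSimplex n, mbar r K J x = (⨅ x' ∈ openSimplex n, mbar r K J x') → x = w) ∧
      (∀ x ∈ closedSimplex n, munder r K J x = (⨆ x' ∈ openSimplex n, munder r K J x') → x = w) ∧
      (∀ x ∈ openSimplex n,
        munder r K J x ≤ (⨅ x' ∈ openSimplex n, mbar r K J x') ∧
        (⨆ x' ∈ openSimplex n, munder r K J x') ≤ mbar r K J x) := by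
  obtain ⟨w, hwS, hw⟩ := exists_equioscillation hn hr hK hsing hsc hsm hJ hJusc
  have hfin : ∀ x ∈ closedSimplex n, Equioscillation r K J x → ∀ j, mj r K J j x ≠ ⊥ :=
    fun x hx he j => he.mj_eq_mbar j ▸ mbar_ne_bot hn hK hsm hJ hx
  have hwO : w ∈ openSimplex n := mem_openSimplex hn hr hsing hwS (hfin w hwS hw)
  have hcomp : ∀ {x y : Fin n → ℝ}, x ∈ closedSimplex n → y ∈ closedSimplex n → x ≠ y →
      (∀ j, mj r K J j y ≠ ⊥) → ∃ j, mj r K J j y < mj r K J j x :=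
    fun hx hy => exists_mj_lt hn hr hK hsing hsc hsm hJ.1 hJusc hx hy
  have hup : ∀ x ∈ closedSimplex n, x ≠ w → mbar r K J w < mbar r K J x := by
    intro x hx hne
    obtain ⟨j, hj⟩ := hcomp hx hwS hne (hfin w hwS hw)
    exact hw.mj_eq_mbar j ▸ hj.trans_le (mj_le_mbar r K J x j)
  have heq : munder r K J w = mbar r K J w := (hw.mj_eq_munder 0).symm.trans (hw.mj_eq_mbar 0)
  have hdown : ∀ x ∈ closedSimplex n, x ≠ w → munder r K J x < munder r K J w := by
    intro x hx hne
    by_cases hxfin : ∀ j, mj r K J j x ≠ ⊥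
    · obtain ⟨j, hj⟩ := hcomp hwS hx hne.symm hxfin
      exact hw.mj_eq_munder j ▸ (munder_le_mj r K J x j).trans_lt hj
    · push Not at hxfin
      obtain ⟨j, hj⟩ := hxfin
      have hbot : munder r K J x = ⊥ := le_bot_iff.1 (hj ▸ munder_le_mj r K J x j)
      rw [hbot, heq]
      exact bot_lt_iff_ne_bot.2 (mbar_ne_bot hn hK hsm hJ hwS)
  have hup' : ∀ x ∈ closedSimplex n, mbar r K J w ≤ mbar r K J x := fun x hx => by
    by_cases hxw : x = w
    exacts [hxw ▸ le_rfl, (hup x hx hxw).le]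
  have hdown' : ∀ x ∈ closedSimplex n, munder r K J x ≤ munder r K J w := fun x hx => by
    by_cases hxw : x = w
    exacts [hxw ▸ le_rfl, (hdown x hx hxw).le]
  have hsub := openSimplex_subset_closedSimplex n
  have hinf : (⨅ x ∈ openSimplex n, mbar r K J x) = mbar r K J w :=
    le_antisymm (iInf₂_le w hwO) (le_iInf₂ fun x hx => hup' x (hsub hx))
  have hsup : (⨆ x ∈ openSimplex n, munder r K J x) = munder r K J w :=
    le_antisymm (iSup₂_le fun x hx => hdown' x (hsub hx))
      (le_iSup₂ (f := fun x (_ : x ∈ openSimplex n) => munder r K J x) w hwO)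
  rw [hinf, hsup]
  refine ⟨heq.symm, w, ⟨hwO, hfin w hwS hw⟩, hw, rfl, rfl, fun x hx he => ?_,
    fun x hx he => by_contra fun hne => (hup x hx hne).ne' he,
    fun x hx he => by_contra fun hne => (hdown x hx hne).ne he,
    fun x hx => ⟨heq ▸ hdown' x (hsub hx), heq ▸ hup' x (hsub hx)⟩⟩
  by_contra hne
  have h1 := hup x hx hne
  have h2 := hdown x hx hne
  rw [← he.mj_eq_munder 0, he.mj_eq_mbar 0, heq] at h2
  exact lt_asymm h1 h2
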